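/- Strong detectability and strong periodic detectability are incomparable. Concretely, over the trivial monoid (so all transitions are instantaneous): (a) the labeled weighted automaton A₁ with states q₀, q₁, both initial, a single unobservable event u (ℓ(u) = ε), and transitions q₀ →^{u} q₀ and q₁ →^{u} q₁, is strongly detectable but not strongly periodically detectable; (b) the labeled weighted automaton A₂ with states q₀, q₁, q₂, unique initial state q₀, observable events a, b with ℓ(a) = a, ℓ(b) = b, and transitions q₀ →^{a} q₁, q₀ →^{a} q₂, q₁ →^{b} q₀ and q₂ →^{b} q₀, is strongly periodically detectable but not strongly detectable. -/

import Mathlib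

namespace LWAD

/-- A labeled weighted automaton over a monoid `T`: `lbl e = none` means that
event `e` is unobservable (label ε); initial states all have initial weight `1`. -/
structure LWA (T Q E S : Type*) [Monoid T] where
  trans : Set (Q × E × Q)
  init : Set Q
  wt : Q → E → Q → T
  lbl : E → Option S

variable {T Q E S : Type*} [Monoid T]

/-- A chain (path) over a labeled transition relation `r`; each entry of the
list records the letter and the next state. -/
def Chain {V α : Type*} (r : V → α → V → Prop) : V → List (α × V) → Prop
  | _, [] => True
  | v, (a, u) :: l => r v a u ∧ Chain r u l

/-- The final state of a chain. -/
def chainEnd {V α : Type*} (v : V) (l : List (α × V)) : V :=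
  (l.getLast?.map Prod.snd).getD v

/-- `v'` is reachable from `v` via the labeled transition relation `r`. -/
def ReachVia {V α : Type*} (r : V → α → V → Prop) (v v' : V) : Prop :=
  ∃ l, Chain r v l ∧ chainEnd v l = v'

/-- `IsPath A q l`: `l` is a (possibly empty) path of `A` starting at `q`. -/
def IsPath (A : LWA T Q E S) : Q → List (E × Q) → Prop :=
  Chain fun q e q' => (q, e, q') ∈ A.trans

/-- The end state of a path. -/
def pathEnd (q : Q) (l : List (E × Q)) : Q := chainEnd q l

/-- The weight of a path: the ordered product of its transition weights. -/
def pathWeight (A : LWA T Q E S) : Q → List (E × Q) → T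
  | _, [] => 1
  | q, (e, q') :: l => A.wt q e q' * pathWeight A q' l

/-- Weighted word of a path, with accumulated weight `t`. -/
def wwordAux (A : LWA T Q E S) : T → Q → List (E × Q) → List (E × T)
  | _, _, [] => []
  | t, q, (e, q') :: l => (e, t * A.wt q e q') :: wwordAux A (t * A.wt q e q') q' l

/-- τ(π): the weighted word of the path `l` starting at `q`. -/
def pathWWord (A : LWA T Q E S) (q : Q) (l : List (E × Q)) : List (E × T) :=
  wwordAux A 1 q l

/-- All events of the path are unobservable. -/
def Unobs (A : LWA T Q E S) (l : List (E × Q)) : Prop := ∀ p ∈ l, A.lbl p.1 = none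

/-- The path is instantaneous: all entries of its weighted word equal `1`. -/
def Inst (A : LWA T Q E S) (q : Q) (l : List (E × Q)) : Prop :=
  ∀ p ∈ pathWWord A q l, p.2 = 1

/-- The labeling `ℓ` extended letterwise to weighted words. -/
def obsW (A : LWA T Q E S) (w : List (E × T)) : List (S × T) :=
  w.filterMap fun p => (A.lbl p.1).map fun σ => (σ, p.2)

/-- `M(A, ε | x)`: states reachable from `x` by unobservable instantaneous paths. -/
def instClosure (A : LWA T Q E S) (x : Set Q) : Set Q :=
  {q | ∃ q₀ ∈ x, ∃ l, IsPath A q₀ l ∧ Unobs A l ∧ Inst A q₀ l ∧ pathEnd q₀ l = q}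

/-- `M(A, γ | x)` for nonempty weighted label sequences `γ`. -/
def estPos (A : LWA T Q E S) (x : Set Q) (γ : List (S × T)) : Set Q :=
  {q | ∃ q₀ ∈ x, ∃ s₁ s₂ : List (E × Q),
        IsPath A q₀ (s₁ ++ s₂) ∧
        (∃ p, s₁.getLast? = some p ∧ A.lbl p.1 ≠ none) ∧
        obsW A (pathWWord A q₀ s₁) = γ ∧
        Unobs A s₂ ∧ Inst A (pathEnd q₀ s₁) s₂ ∧
        pathEnd (pathEnd q₀ s₁) s₂ = q}

/-- The current-state estimate `M(A, γ | x)`. -/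
def est (A : LWA T Q E S) (x : Set Q) : List (S × T) → Set Q
  | [] => instClosure A x
  | γ => estPos A x γ

/-- An infinite path of `A` starting at an initial state. -/
structure InfPath (A : LWA T Q E S) where
  st : ℕ → Q
  ev : ℕ → E
  first : st 0 ∈ A.init
  valid : ∀ i, (st i, ev i, st (i + 1)) ∈ A.trans

/-- The ω-weighted word of an infinite path. -/
def InfPath.wword {A : LWA T Q E S} (π : InfPath A) (i : ℕ) : E × T :=
  (π.ev i, ((List.range (i + 1)).map fun j => A.wt (π.st j) (π.ev j) (π.st (j + 1))).prod)

/-- `L^ω(A)`: the ω-weighted words of infinite initial paths of `A`. -/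
def omegaLang (A : LWA T Q E S) : Set (ℕ → E × T) :=
  {w | ∃ π : InfPath A, ∀ i, π.wword i = w i}

/-- The length-`n` prefix of an infinite word. -/
def pre {β : Type*} (w : ℕ → β) (n : ℕ) : List β := (List.range n).map w

/-- The segment `w(n) ⋯ w(n+k-1)` of an infinite word. -/
def seg {β : Type*} (w : ℕ → β) (n k : ℕ) : List β := (List.range k).map fun i => w (n + i)

def StronglyDetectable (A : LWA T Q E S) : Prop :=
  ∃ t : ℕ, 0 < t ∧ ∀ w ∈ omegaLang A, ∀ n : ℕ,
    t ≤ (obsW A (pre w n)).length → (est A A.init (obsW A (pre w n))).ncard = 1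

def StronglyPeriodicallyDetectable (A : LWA T Q E S) : Prop :=
  ∃ t : ℕ, 0 < t ∧ ∀ w ∈ omegaLang A, ∀ n : ℕ, ∃ k : ℕ,
    (obsW A (seg w n k)).length < t ∧
    (est A A.init (obsW A (pre w (n + k)))).ncard = 1

def WeaklyDetectable (A : LWA T Q E S) : Prop :=
  (omegaLang A).Nonempty → ∃ t : ℕ, 0 < t ∧ ∃ w ∈ omegaLang A, ∀ n : ℕ,
    t ≤ (obsW A (pre w n)).length → (est A A.init (obsW A (pre w n))).ncard = 1

def WeaklyPeriodicallyDetectable (A : LWA T Q E S) : Prop :=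
  (omegaLang A).Nonempty → ∃ t : ℕ, 0 < t ∧ ∃ w ∈ omegaLang A, ∀ n : ℕ, ∃ k : ℕ,
    (obsW A (seg w n k)).length < t ∧
    (est A A.init (obsW A (pre w (n + k)))).ncard = 1

def Reachable (A : LWA T Q E S) (q : Q) : Prop :=
  ∃ q₀ ∈ A.init, ∃ l, IsPath A q₀ l ∧ pathEnd q₀ l = q

def DeadlockFree (A : LWA T Q E S) : Prop :=
  ∀ q, Reachable A q → ∃ e q', (q, e, q') ∈ A.trans

def DivergenceFree (A : LWA T Q E S) : Prop :=
  ¬ ∃ q, Reachable A q ∧ ∃ l, l ≠ [] ∧ IsPath A q l ∧ Unobs A l ∧ pathEnd q l = q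

def Deterministic (A : LWA T Q E S) : Prop :=
  (∃ q, A.init = {q}) ∧
  ∀ q e q' q'', (q, e, q') ∈ A.trans → (q, e, q'') ∈ A.trans → q' = q''

/-- The transition relation of the self-composition `CC(A)`. -/
def CCTrans (A : LWA T Q E S) (p : Q × Q) (ee : E × E) (p' : Q × Q) : Prop :=
  A.lbl ee.1 ≠ none ∧ A.lbl ee.1 = A.lbl ee.2 ∧
  ∃ (s₁ s₂ s₃ s₄ : List (E × Q)) (q₇ q₈ : Q),
    IsPath A p.1 (s₁ ++ (ee.1, q₇) :: s₃) ∧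
    IsPath A p.2 (s₂ ++ (ee.2, q₈) :: s₄) ∧
    Unobs A s₁ ∧ Unobs A s₂ ∧ Unobs A s₃ ∧ Unobs A s₄ ∧
    Inst A q₇ s₃ ∧ Inst A q₈ s₄ ∧
    pathEnd q₇ s₃ = p'.1 ∧ pathEnd q₈ s₄ = p'.2 ∧
    pathWeight A p.1 (s₁ ++ [(ee.1, q₇)]) = pathWeight A p.2 (s₂ ++ [(ee.2, q₈)])

/-- The state set `X` of the pre-observer of `A`. -/
def obsStates (A : LWA T Q E S) : Set (Set Q) :=
  insert (est A A.init []) {x | x.Nonempty ∧ ∃ γ : List (S × T), γ ≠ [] ∧ est A A.init γ = x}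

/-- The transition relation of the pre-observer of `A`. -/
def PreObsTrans (A : LWA T Q E S) (x : Set Q) (st : S × T) (x' : Set Q) : Prop :=
  x ∈ obsStates A ∧ x' ∈ obsStates A ∧ x' = estPos A x [st]

/-- An observer of `A`: a finite-alphabet subautomaton of its pre-observer that
keeps at least one transition between every connected pair of states. -/
structure Observer (A : LWA T Q E S) where
  alph : Set (S × T)
  alph_fin : alph.Finite
  tr : Set (Set Q × (S × T) × Set Q)
  tr_sub : ∀ x st x', (x, st, x') ∈ tr → st ∈ alph ∧ PreObsTrans A x st x'
  tr_cover : ∀ x x', (∃ st, PreObsTrans A x st x') → ∃ st, (x, st, x') ∈ tr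

def ObsRel {A : LWA T Q E S} (O : Observer A) (x : Set Q) (st : S × T) (x' : Set Q) : Prop :=
  (x, st, x') ∈ O.tr

/-- The state set of the pre-detector of `A`. -/
def detStates (A : LWA T Q E S) : Set (Set Q) :=
  insert (est A A.init []) {x | 1 ≤ x.ncard ∧ x.ncard ≤ 2}

/-- The transition relation of the pre-detector of `A`. -/
def PreDetTrans (A : LWA T Q E S) (x : Set Q) (st : S × T) (x' : Set Q) : Prop :=
  x ∈ detStates A ∧
  (((estPos A x [st]).ncard = 1 ∧ x' = estPos A x [st]) ∨
    (2 ≤ (estPos A x [st]).ncard ∧ x' ⊆ estPos A x [st] ∧ x'.ncard = 2))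

/-- A detector of `A`: a finite-alphabet subautomaton of its pre-detector that
keeps at least one transition between every connected pair of states. -/
structure Detector (A : LWA T Q E S) where
  alph : Set (S × T)
  alph_fin : alph.Finite
  tr : Set (Set Q × (S × T) × Set Q)
  tr_sub : ∀ x st x', (x, st, x') ∈ tr → st ∈ alph ∧ PreDetTrans A x st x'
  tr_cover : ∀ x x', (∃ st, PreDetTrans A x st x') → ∃ st, (x, st, x') ∈ tr

def DetRel {A : LWA T Q E S} (D : Detector A) (x : Set Q) (st : S × T) (x' : Set Q) : Prop :=
  (x, st, x') ∈ D.tr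


/-- The automaton `A₁` over the trivial monoid: states `q₀ = false`, `q₁ = true`
(both initial), one unobservable event `u` with self-loops on both states. -/
def A1ex : LWA Unit Bool Unit Unit where
  trans := {t | t = (false, (), false) ∨ t = (true, (), true)}
  init := Set.univ
  wt := fun _ _ _ => 1
  lbl := fun _ => none

/-- The automaton `A₂` over the trivial monoid: states `q₀ = 0`, `q₁ = 1`,
`q₂ = 2`, unique initial state `0`, observable events `a = false` and
`b = true` with `ℓ(a) = a`, `ℓ(b) = b`, and transitions `q₀ →ᵃ q₁`,
`q₀ →ᵃ q₂`, `q₁ →ᵇ q₀`, `q₂ →ᵇ q₀`. -/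
def A2ex : LWA Unit (Fin 3) Bool Bool where
  trans := {t | t = (0, false, 1) ∨ t = (0, false, 2) ∨
                t = (1, true, 0) ∨ t = (2, true, 0)}
  init := {0}
  wt := fun _ _ _ => 1
  lbl := fun e => some e

theorem chain_snoc {V α : Type*} (r : V → α → V → Prop) (v : V) (l : List (α × V)) (a : α) (u : V) :
    Chain r v (l ++ [(a, u)]) ↔ Chain r v l ∧ r (chainEnd v l) a u := by
  induction l generalizing v with
  | nil => simp [Chain, chainEnd]
  | cons p l ih =>
    obtain ⟨b, x⟩ := p
    have h : chainEnd v ((b, x) :: l) = chainEnd x l := by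
      cases l with
      | nil => simp [chainEnd]
      | cons c l => simp [chainEnd, List.getLast?_cons]
    simp only [List.cons_append, Chain, ih, h, and_assoc]

theorem chainEnd_snoc {V α : Type*} (v : V) (l : List (α × V)) (a : α) (u : V) :
    chainEnd v (l ++ [(a, u)]) = u := by
  simp [chainEnd]

theorem A1_obs (w : List (Unit × Unit)) : obsW A1ex w = [] := by
  simp [obsW, A1ex]

theorem A1_est : (est A1ex A1ex.init []) = Set.univ := by
  ext q
  simp only [est, instClosure, Set.mem_univ, iff_true]
  exact ⟨q, Set.mem_univ _, [], trivial, by simp [Unobs], by simp [Inst, pathWWord, wwordAux], rfl⟩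

theorem A2_obs (w : List (Bool × Unit)) : obsW A2ex w = w := by
  simp [obsW, A2ex]

theorem A2_wword (t : Unit) (q : Fin 3) (l : List (Bool × Fin 3)) :
    wwordAux A2ex t q l = l.map fun p => (p.1, ()) := by
  induction l generalizing t q with
  | nil => rfl
  | cons p l ih => simp [wwordAux, ih]

theorem A2_mem_est (γ : List (Bool × Unit)) (q : Fin 3) :
    q ∈ est A2ex A2ex.init γ ↔
      ∃ l, IsPath A2ex 0 l ∧ pathEnd 0 l = q ∧ (l.map fun p => (p.1, ())) = γ := by
  have hun : ∀ l, Unobs A2ex l → l = [] := by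
    intro l h
    cases l with
    | nil => rfl
    | cons p l => exact absurd (h p (by simp)) (by simp [A2ex])
  have hi : A2ex.init = {0} := rfl
  cases γ with
  | nil =>
    simp only [est, instClosure, Set.mem_setOf_eq, hi, Set.mem_singleton_iff]
    constructor
    · rintro ⟨_, rfl, l, h1, h2, _, h4⟩
      exact ⟨l, h1, h4, by simp [hun l h2]⟩
    · rintro ⟨l, h1, h2, h3⟩
      have : l = [] := by simpa using h3
      subst this
      exact ⟨0, rfl, [], h1, by simp [Unobs], by simp [Inst, pathWWord, wwordAux], h2⟩
  | cons c γ =>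
    simp only [est, estPos, Set.mem_setOf_eq, hi, Set.mem_singleton_iff, pathWWord, A2_wword, A2_obs]
    constructor
    · rintro ⟨_, rfl, l, l2, h1, _, h3, h4, _, h6⟩
      have := hun l2 h4
      subst this
      exact ⟨l, by simpa using h1, h6, h3⟩
    · rintro ⟨l, h1, h2, h3⟩
      refine ⟨0, rfl, l, [], by simpa using h1, ?_, h3, by simp [Unobs],
        by simp [Inst, pathWWord, wwordAux], h2⟩
      have hl : l ≠ [] := by
        rintro rfl
        simp at h3
      exact ⟨l.getLast hl, List.getLast?_eq_some_getLast hl, by simp [A2ex]⟩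

theorem A2_parity (l : List (Bool × Fin 3)) (h : IsPath A2ex 0 l) :
    (l.length % 2 = 0 ↔ pathEnd 0 l = 0) := by
  induction l using List.reverseRecOn with
  | nil => simp [pathEnd, chainEnd]
  | append_singleton l p ih =>
    obtain ⟨a, u⟩ := p
    have h' := (chain_snoc _ _ _ _ _).1 h
    have ih' := ih h'.1
    have ht := h'.2
    simp only [pathEnd] at ih' ⊢
    rw [chainEnd_snoc, List.length_append]
    simp only [A2ex, Set.mem_setOf_eq, Prod.mk.injEq] at ht
    rcases ht with ⟨h1, -, rfl⟩ | ⟨h1, -, rfl⟩ | ⟨h1, -, rfl⟩ | ⟨h1, -, rfl⟩ <;>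
      rw [h1] at ih' <;> simp at ih' ⊢ <;> omega

theorem A2_prefix (π : InfPath A2ex) (n : ℕ) :
    IsPath A2ex 0 ((List.range n).map fun i => (π.ev i, π.st (i + 1))) ∧
    pathEnd 0 ((List.range n).map fun i => (π.ev i, π.st (i + 1))) = π.st n := by
  induction n with
  | zero => exact ⟨trivial, (show π.st 0 = 0 from π.first).symm⟩
  | succ n ih =>
    rw [List.range_succ, List.map_append, List.map_singleton]
    refine ⟨(chain_snoc _ _ _ _ _).2 ⟨ih.1, ?_⟩, chainEnd_snoc _ _ _ _⟩
    have := ih.2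
    unfold pathEnd at this
    rw [this]
    exact π.valid n

theorem A2_even (w : ℕ → Bool × Unit) (hw : w ∈ omegaLang A2ex) (n : ℕ) (hn : n % 2 = 0) :
    (est A2ex A2ex.init (obsW A2ex (pre w n))).ncard = 1 := by
  obtain ⟨π, hπ⟩ := hw
  rw [Set.ncard_eq_one]
  refine ⟨0, ?_⟩
  ext q
  rw [A2_mem_est, A2_obs, Set.mem_singleton_iff]
  constructor
  · rintro ⟨l, h1, h2, h3⟩
    have hl : l.length = n := by simpa [pre] using congrArg List.length h3
    rw [← h2]
    exact (A2_parity l h1).1 (by omega)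
  · rintro rfl
    have h := A2_prefix π n
    refine ⟨_, h.1, (A2_parity _ h.1).1 (by simpa using hn), ?_⟩
    simp only [pre, List.map_map]
    refine List.map_congr_left fun i _ => ?_
    rw [← hπ i]
    rfl

/-- The alternating infinite path of `A₂`. -/
def A2alt : InfPath A2ex where
  st i := if i % 2 = 0 then 0 else 1
  ev i := if i % 2 = 0 then false else true
  first := rfl
  valid i := by
    rcases Nat.mod_two_eq_zero_or_one i with h | h
    · have h' : (i + 1) % 2 = 1 := by omega
      simp [h, h', A2ex]
    · have h' : (i + 1) % 2 = 0 := by omega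
      simp [h, h', A2ex]

/-- Strong detectability and strong periodic detectability are incomparable:
`A₁` is strongly detectable but not strongly periodically detectable, while
`A₂` is strongly periodically detectable but not strongly detectable. -/
theorem strong_and_strongPeriodic_detectability_incomparable :
    (StronglyDetectable A1ex ∧ ¬ StronglyPeriodicallyDetectable A1ex) ∧
      (StronglyPeriodicallyDetectable A2ex ∧ ¬ StronglyDetectable A2ex) := by
  refine ⟨⟨⟨1, one_pos, fun w _ n h => ?_⟩, ?_⟩, ⟨2, two_pos, fun w hw n => ?_⟩, ?_⟩
  · rw [A1_obs] at h
    simp at h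
  · rintro ⟨t, _, h⟩
    let π : InfPath A1ex := ⟨fun _ => false, fun _ => (), trivial, fun _ => Or.inl rfl⟩
    obtain ⟨k, _, h⟩ := h π.wword ⟨π, fun _ => rfl⟩ 0
    rw [A1_obs, A1_est, Set.ncard_univ] at h
    simp at h
  · refine ⟨n % 2, ?_, A2_even w hw _ (by omega)⟩
    rw [A2_obs]
    simp only [seg, List.length_map, List.length_range]
    omega
  · rintro ⟨t, _, h⟩
    have h1 := h A2alt.wword ⟨A2alt, fun _ => rfl⟩ (2 * t + 1) (by
      rw [A2_obs]
      simp only [pre, List.length_map, List.length_range]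
      omega)
    obtain ⟨x, hx⟩ := Set.ncard_eq_one.1 h1
    have hp := A2_prefix A2alt (2 * t)
    have h0 : A2alt.st (2 * t) = 0 := by simp [A2alt]
    have key : ∀ u : Fin 3, (u = 1 ∨ u = 2) → u = x := by
      intro u hu
      rw [← Set.mem_singleton_iff, ← hx, A2_mem_est, A2_obs]
      refine ⟨(List.range (2 * t)).map (fun i => (A2alt.ev i, A2alt.st (i + 1))) ++ [(false, u)],
        (chain_snoc _ _ _ _ _).2 ⟨hp.1, ?_⟩, chainEnd_snoc _ _ _ _, ?_⟩
      · have h2 := hp.2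
        unfold pathEnd at h2
        rw [h2, h0]
        rcases hu with rfl | rfl <;> simp [A2ex]
      · simp only [pre, List.range_succ, List.map_append, List.map_map, List.map_singleton]
        congr 1
        simp [InfPath.wword, A2alt]
    have := (key 1 (Or.inl rfl)).trans (key 2 (Or.inr rfl)).symm
    exact absurd this (by decide)

end LWAD
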